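/- Let ρ_{ABC} be a density operator (positive semi-definite matrix with unit trace) acting on a finite-dimensional tensor-product Hilbert space H_A ⊗ H_B ⊗ H_C, with marginals ρ_{AC} = Tr_B{ρ_{ABC}}, ρ_{BC} = Tr_A{ρ_{ABC}}, and ρ_C = Tr_{AB}{ρ_{ABC}}, and suppose ρ_C is positive definite (invertible). Then for reals 2 ≤ q ≤ p, max_{V_{ρ_C}} ‖ρ_{AC}^{1/p} (I_A ⊗ V_{ρ_C}) ρ_C^{-1/p} ρ_{BC}^{1/p}‖_p^p ≤ max_{W_{ρ_C}} ‖ρ_{AC}^{1/q} (I_A ⊗ W_{ρ_C}) ρ_C^{-1/q} ρ_{BC}^{1/q}‖_q^q, where the maxima are over unitaries on H_C commuting with ρ_C (here ρ_{AC}^{1/p} acts on H_A ⊗ H_C, ρ_{BC}^{1/p} acts on H_B ⊗ H_C, ρ_C^{-1/p} acts on H_C, and all operators are extended by tensoring with identities so as to act on H_A ⊗ H_B ⊗ H_C); i.e., the quantity max_{V_{ρ_C}} ‖ρ_{AC}^{1/p} V_{ρ_C} ρ_C^{-1/p} ρ_{BC}^{1/p}‖_p^p is monotone non-increasing for p ≥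 2. -/

import Mathlib

noncomputable section

open Matrix
open scoped ENNReal ComplexOrder

/-- Functional calculus of a Hermitian complex matrix applied with a complex-valued
function of its (real) eigenvalues. Returns `0` if the matrix is not Hermitian. -/
def hermFC {n : Type*} [Fintype n] [DecidableEq n] (A : Matrix n n ℂ) (f : ℝ → ℂ) :
    Matrix n n ℂ :=
  if hA : A.IsHermitian then
    (hA.eigenvectorUnitary : Matrix n n ℂ) * Matrix.diagonal (f ∘ hA.eigenvalues) *
      (star hA.eigenvectorUnitary : Matrix n n ℂ)
  else 0

/-- Complex power `A ^ z` of a positive semi-definite matrix, defined by functional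
calculus on eigenvalues, with eigenvalue `0` mapped to `0`. -/
def mpow {n : Type*} [Fintype n] [DecidableEq n] (A : Matrix n n ℂ) (z : ℂ) :
    Matrix n n ℂ :=
  hermFC A (fun x => if x = 0 then 0 else (x : ℂ) ^ z)

/-- The Schatten `p`-norm `(Tr |X|^p)^(1/p)` of a complex matrix, where
`|X|^p = (Xᴴ X)^(p/2)` is given by functional calculus. -/
def schattenNorm {n : Type*} [Fintype n] [DecidableEq n] (p : ℝ) (X : Matrix n n ℂ) : ℝ :=
  ((mpow (Xᴴ * X) ((p / 2 : ℝ) : ℂ)).trace).re ^ (1 / p)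

/-- The operator norm (largest singular value) of a complex matrix. -/
def opNorm {n : Type*} [Fintype n] [DecidableEq n] (X : Matrix n n ℂ) : ℝ :=
  ‖Matrix.toEuclideanCLM (𝕜 := ℂ) X‖

/-- Schatten norm with exponent in `[1,∞]`: the operator norm when `p = ∞`. -/
def schattenNormE {n : Type*} [Fintype n] [DecidableEq n] (p : ℝ≥0∞) (X : Matrix n n ℂ) :
    ℝ :=
  if p = ⊤ then opNorm X else schattenNorm p.toReal X

/-- Matrix logarithm of a Hermitian matrix via functional calculus. -/
def mlog {n : Type*} [Fintype n] [DecidableEq n] (A : Matrix n n ℂ) : Matrix n n ℂ :=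
  hermFC A (fun x => ((Real.log x : ℝ) : ℂ))

/-- Matrix exponential of a Hermitian matrix via functional calculus. -/
def mexp {n : Type*} [Fintype n] [DecidableEq n] (A : Matrix n n ℂ) : Matrix n n ℂ :=
  hermFC A (fun x => ((Real.exp x : ℝ) : ℂ))

/-- `α_θ(t) = sin(πθ)/(2(1-θ)[cosh(πt) - cos(πθ)])`. -/
def alphaW (θ t : ℝ) : ℝ :=
  Real.sin (Real.pi * θ) / (2 * (1 - θ) * (Real.cosh (Real.pi * t) - Real.cos (Real.pi * θ)))

/-- `β_θ(t) = sin(πθ)/(2θ[cosh(πt) + cos(πθ)])`. -/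
def betaW (θ t : ℝ) : ℝ :=
  Real.sin (Real.pi * θ) / (2 * θ * (Real.cosh (Real.pi * t) + Real.cos (Real.pi * θ)))

/-- `β₀(t) = π/(2[cosh(πt) + 1])`. -/
def betaZero (t : ℝ) : ℝ := Real.pi / (2 * (Real.cosh (Real.pi * t) + 1))

/-- Partial trace over the first tensor factor `A` of an operator on `H_A ⊗ H_B ⊗ H_C`. -/
def ptraceA {A B C : Type*} [Fintype A]
    (ρ : Matrix (A × B × C) (A × B × C) ℂ) : Matrix (B × C) (B × C) ℂ :=
  Matrix.of fun x y => ∑ a : A, ρ (a, x) (a, y)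

/-- Partial trace over the middle tensor factor `B` of an operator on `H_A ⊗ H_B ⊗ H_C`. -/
def ptraceB {A B C : Type*} [Fintype B]
    (ρ : Matrix (A × B × C) (A × B × C) ℂ) : Matrix (A × C) (A × C) ℂ :=
  Matrix.of fun x y => ∑ b : B, ρ (x.1, b, x.2) (y.1, b, y.2)

/-- Partial trace over the factors `A` and `B` of an operator on `H_A ⊗ H_B ⊗ H_C`. -/
def ptraceAB {A B C : Type*} [Fintype A] [Fintype B]
    (ρ : Matrix (A × B × C) (A × B × C) ℂ) : Matrix C C ℂ :=
  Matrix.of fun c c' => ∑ a : A, ∑ b : B, ρ (a, b, c) (a, b, c')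

/-- Extension `M_{AC} ⊗ I_B` of an operator on `H_A ⊗ H_C` to `H_A ⊗ H_B ⊗ H_C`. -/
def extAC {A B C : Type*} [DecidableEq B]
    (M : Matrix (A × C) (A × C) ℂ) : Matrix (A × B × C) (A × B × C) ℂ :=
  Matrix.of fun x y => (if x.2.1 = y.2.1 then 1 else 0) * M (x.1, x.2.2) (y.1, y.2.2)

/-- Extension `I_A ⊗ M_{BC}` of an operator on `H_B ⊗ H_C` to `H_A ⊗ H_B ⊗ H_C`. -/
def extBC {A B C : Type*} [DecidableEq A]
    (M : Matrix (B × C) (B × C) ℂ) : Matrix (A × B × C) (A × B × C) ℂ :=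
  Matrix.of fun x y => (if x.1 = y.1 then 1 else 0) * M x.2 y.2

/-- Extension `I_A ⊗ I_B ⊗ M_C` of an operator on `H_C` to `H_A ⊗ H_B ⊗ H_C`. -/
def extC {A B C : Type*} [DecidableEq A] [DecidableEq B]
    (M : Matrix C C ℂ) : Matrix (A × B × C) (A × B × C) ℂ :=
  Matrix.of fun x y =>
    (if x.1 = y.1 then 1 else 0) * (if x.2.1 = y.2.1 then 1 else 0) * M x.2.2 y.2.2

section SchattenInterpolation

open scoped Matrix.Norms.L2Operator

variable {n : Type*} [Fintype n] [DecidableEq n]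

/-- The `i`-th column of a matrix as a Euclidean vector. -/
def euclideanCol (M : Matrix n n ℂ) (i : n) : EuclideanSpace ℂ n :=
  WithLp.toLp 2 (M.col i)

omit [DecidableEq n] in
lemma inner_euclideanCol (M N : Matrix n n ℂ) (i j : n) :
    inner ℂ (euclideanCol M i) (euclideanCol N j) = (Mᴴ * N) i j := by
  simp [euclideanCol, PiLp.inner_apply, Matrix.mul_apply, mul_comm]

omit [DecidableEq n] in
lemma norm_euclideanCol_sq (M : Matrix n n ℂ) (i : n) :
    ‖euclideanCol M i‖ ^ 2 = ((Mᴴ * M) i i).re := by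
  rw [← inner_euclideanCol, inner_self_eq_norm_sq_to_K]
  norm_cast

lemma norm_euclideanCol_mul_le (M N : Matrix n n ℂ) (i : n) :
    ‖euclideanCol (M * N) i‖ ≤ ‖M‖ * ‖euclideanCol N i‖ :=
  Matrix.l2_opNorm_mulVec M (euclideanCol N i)

lemma norm_euclideanCol_unitary_mul {U : Matrix n n ℂ} (hU : U ∈ Matrix.unitaryGroup n ℂ)
    (N : Matrix n n ℂ) (i : n) :
    ‖euclideanCol (U * N) i‖ = ‖euclideanCol N i‖ := by
  have hU' : Uᴴ * U = 1 := Matrix.mem_unitaryGroup_iff'.1 hU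
  rw [← sq_eq_sq₀ (norm_nonneg _) (norm_nonneg _), norm_euclideanCol_sq, norm_euclideanCol_sq,
    conjTranspose_mul, Matrix.mul_assoc, ← Matrix.mul_assoc Uᴴ, hU', Matrix.one_mul]

lemma norm_euclideanCol_unitary {U : Matrix n n ℂ} (hU : U ∈ Matrix.unitaryGroup n ℂ) (i : n) :
    ‖euclideanCol U i‖ = 1 := by
  have hU' : Uᴴ * U = 1 := Matrix.mem_unitaryGroup_iff'.1 hU
  rw [← sq_eq_sq₀ (norm_nonneg _) zero_le_one, norm_euclideanCol_sq, hU']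
  simp

lemma norm_euclideanCol_le {M U : Matrix n n ℂ} (hU : U ∈ Matrix.unitaryGroup n ℂ) (i : n) :
    ‖euclideanCol (M * U) i‖ ≤ ‖M‖ := by
  simpa [norm_euclideanCol_unitary hU] using norm_euclideanCol_mul_le M U i

/-- `Tr |X| ^ p`, the `p`-th power of the Schatten norm. -/
def schattenTrace (p : ℝ) (X : Matrix n n ℂ) : ℝ :=
  ((mpow (Xᴴ * X) ((p / 2 : ℝ) : ℂ)).trace).re

/-- An orthonormal basis of right singular vectors of a matrix. -/
def rightSingular (X : Matrix n n ℂ) : Matrix n n ℂ :=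
  (Matrix.isHermitian_conjTranspose_mul_self X).eigenvectorUnitary

lemma rightSingular_mem (X : Matrix n n ℂ) : rightSingular X ∈ Matrix.unitaryGroup n ℂ :=
  (Matrix.isHermitian_conjTranspose_mul_self X).eigenvectorUnitary.2

/-- The singular values of a matrix, as lengths of the images of the right singular vectors. -/
def singVal (X : Matrix n n ℂ) (i : n) : ℝ := ‖euclideanCol (X * rightSingular X) i‖

lemma singVal_nonneg (X : Matrix n n ℂ) (i : n) : 0 ≤ singVal X i := norm_nonneg _

lemma conjTranspose_mul_self_eq (X : Matrix n n ℂ) :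
    Xᴴ * X = rightSingular X *
      diagonal (fun i =>
        (((Matrix.isHermitian_conjTranspose_mul_self X).eigenvalues i : ℝ) : ℂ)) *
      (rightSingular X)ᴴ := by
  conv_lhs => rw [(Matrix.isHermitian_conjTranspose_mul_self X).spectral_theorem]
  rfl

lemma singVal_sq (X : Matrix n n ℂ) (i : n) :
    singVal X i ^ 2 = (Matrix.isHermitian_conjTranspose_mul_self X).eigenvalues i := by
  have hE : (rightSingular X)ᴴ * rightSingular X = 1 :=
    Matrix.mem_unitaryGroup_iff'.1 (rightSingular_mem X)
  have hdiag : (rightSingular X)ᴴ * (Xᴴ * X) * rightSingular X = diagonal (fun i =>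
      (((Matrix.isHermitian_conjTranspose_mul_self X).eigenvalues i : ℝ) : ℂ)) := by
    conv_lhs => rw [conjTranspose_mul_self_eq X]
    rw [Matrix.mul_assoc, Matrix.mul_assoc, hE, Matrix.mul_one, ← Matrix.mul_assoc, hE,
      Matrix.one_mul]
  rw [singVal, norm_euclideanCol_sq, conjTranspose_mul, Matrix.mul_assoc, ← Matrix.mul_assoc Xᴴ,
    ← Matrix.mul_assoc, hdiag]
  simp

lemma conjTranspose_mul_self_eq_singVal (X : Matrix n n ℂ) :
    Xᴴ * X = rightSingular X * diagonal (fun i => ((singVal X i ^ 2 : ℝ) : ℂ)) *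
      (rightSingular X)ᴴ := by
  simp_rw [singVal_sq]
  exact conjTranspose_mul_self_eq X

lemma schattenTrace_eq_sum {p : ℝ} (hp : 0 < p) (X : Matrix n n ℂ) :
    schattenTrace p X = ∑ i, singVal X i ^ p := by
  have hE : (rightSingular X)ᴴ * rightSingular X = 1 :=
    Matrix.mem_unitaryGroup_iff'.1 (rightSingular_mem X)
  rw [schattenTrace, mpow, hermFC, dif_pos (Matrix.isHermitian_conjTranspose_mul_self X)]
  change ((rightSingular X * _ * (rightSingular X)ᴴ).trace).re = _
  rw [Matrix.trace_mul_comm, ← Matrix.mul_assoc, hE, Matrix.one_mul, Matrix.trace_diagonal,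
    Complex.re_sum]
  refine Finset.sum_congr rfl fun i _ => ?_
  rw [Function.comp_apply, ← singVal_sq]
  have h0 := singVal_nonneg X i
  split_ifs with h
  · rw [(pow_eq_zero_iff two_ne_zero).1 h, Real.zero_rpow hp.ne', Complex.zero_re]
  · rw [← Complex.ofReal_cpow (sq_nonneg _), Complex.ofReal_re, ← Real.rpow_natCast,
      ← Real.rpow_mul h0]
    congr 1
    push_cast
    ring

lemma schattenTrace_nonneg {p : ℝ} (hp : 0 < p) (X : Matrix n n ℂ) : 0 ≤ schattenTrace p X := by
  rw [schattenTrace_eq_sum hp]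
  exact Finset.sum_nonneg fun i _ => Real.rpow_nonneg (singVal_nonneg X i) p

lemma schattenNorm_rpow {p : ℝ} (hp : 0 < p) (X : Matrix n n ℂ) :
    schattenNorm p X ^ p = schattenTrace p X := by
  change (schattenTrace p X ^ (1 / p)) ^ p = _
  rw [← Real.rpow_mul (schattenTrace_nonneg hp X), one_div, inv_mul_cancel₀ hp.ne', Real.rpow_one]

lemma schattenTrace_le_card_mul {p : ℝ} (hp : 0 < p) (X : Matrix n n ℂ) :
    schattenTrace p X ≤ Fintype.card n * ‖X‖ ^ p := by
  rw [schattenTrace_eq_sum hp, ← nsmul_eq_mul, ← Finset.card_univ, ← Finset.sum_const]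
  exact Finset.sum_le_sum fun i _ => Real.rpow_le_rpow (singVal_nonneg X i)
    (norm_euclideanCol_le (rightSingular_mem X) i) hp.le

/-- The Peierls inequality: the `p`-th powers of the lengths of the images of an orthonormal
basis sum to at most `Tr |X| ^ p`. -/
lemma sum_norm_euclideanCol_rpow_le {p : ℝ} (hp : 2 ≤ p) (X : Matrix n n ℂ) {U : Matrix n n ℂ}
    (hU : U ∈ Matrix.unitaryGroup n ℂ) :
    ∑ i, ‖euclideanCol (X * U) i‖ ^ p ≤ schattenTrace p X := by
  set O : Matrix n n ℂ := (rightSingular X)ᴴ * U with hO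
  have hE : (rightSingular X) * (rightSingular X)ᴴ = 1 :=
    Matrix.mem_unitaryGroup_iff.1 (rightSingular_mem X)
  have hE' : (rightSingular X)ᴴ * (rightSingular X) = 1 :=
    Matrix.mem_unitaryGroup_iff'.1 (rightSingular_mem X)
  have hU' : U * Uᴴ = 1 := Matrix.mem_unitaryGroup_iff.1 hU
  have hU'' : Uᴴ * U = 1 := Matrix.mem_unitaryGroup_iff'.1 hU
  have hOc : Oᴴ * O = 1 := by
    rw [hO, conjTranspose_mul, conjTranspose_conjTranspose, Matrix.mul_assoc,
      ← Matrix.mul_assoc (rightSingular X), hE, Matrix.one_mul, hU'']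
  have hOr : O * Oᴴ = 1 := by
    rw [hO, conjTranspose_mul, conjTranspose_conjTranspose, Matrix.mul_assoc,
      ← Matrix.mul_assoc U, hU', Matrix.one_mul, hE']
  have hcol (i : n) : ∑ j, ‖O j i‖ ^ 2 = 1 := by
    have := congrArg Complex.re (congrFun (congrFun hOc i) i)
    rw [← norm_euclideanCol_sq, EuclideanSpace.norm_sq_eq] at this
    simpa [euclideanCol] using this
  have hrow (j : n) : ∑ i, ‖O j i‖ ^ 2 = 1 := by
    have := congrFun (congrFun hOr j) j
    simp only [Matrix.mul_apply, conjTranspose_apply, Matrix.one_apply_eq] at this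
    simp only [RCLike.star_def, Complex.mul_conj'] at this
    exact_mod_cast this
  have hsq (i : n) : ‖euclideanCol (X * U) i‖ ^ 2 = ∑ j, ‖O j i‖ ^ 2 * singVal X j ^ 2 := by
    rw [norm_euclideanCol_sq, conjTranspose_mul, Matrix.mul_assoc, ← Matrix.mul_assoc Xᴴ,
      conjTranspose_mul_self_eq_singVal]
    have : Uᴴ * (rightSingular X * diagonal (fun i => ((singVal X i ^ 2 : ℝ) : ℂ)) *
        (rightSingular X)ᴴ * U) =
        Oᴴ * (diagonal (fun i => ((singVal X i ^ 2 : ℝ) : ℂ)) * O) := by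
      simp only [hO, conjTranspose_mul, conjTranspose_conjTranspose, Matrix.mul_assoc]
    rw [this, Matrix.mul_apply, Complex.re_sum]
    refine Finset.sum_congr rfl fun j _ => ?_
    rw [diagonal_mul, conjTranspose_apply, mul_left_comm, RCLike.star_def, Complex.conj_mul',
      mul_comm]
    norm_cast
  have hrp (x : ℝ) (hx : 0 ≤ x) : x ^ p = (x ^ 2) ^ (p / 2) := by
    rw [← Real.rpow_natCast, ← Real.rpow_mul hx]
    congr 1
    push_cast
    ring
  calc ∑ i, ‖euclideanCol (X * U) i‖ ^ p
      ≤ ∑ i, ∑ j, ‖O j i‖ ^ 2 * singVal X j ^ p := by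
        refine Finset.sum_le_sum fun i _ => ?_
        rw [hrp _ (norm_nonneg _), hsq]
        simp_rw [hrp _ (singVal_nonneg X _)]
        exact Real.rpow_arith_mean_le_arith_mean_rpow _ _ _ (fun j _ => sq_nonneg _) (hcol i)
          (fun j _ => sq_nonneg _) (by linarith)
    _ = ∑ j, singVal X j ^ p := by
        rw [Finset.sum_comm]
        simp_rw [← Finset.sum_mul, hrow, one_mul]
    _ = schattenTrace p X := (schattenTrace_eq_sum (by linarith) X).symm
/-- The power `x ^ z` of a real number, with the convention `0 ^ z = 0`. -/
def cpowZero (x : ℝ) (z : ℂ) : ℂ := if x = 0 then 0 else (x : ℂ) ^ z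

lemma norm_cpowZero {x : ℝ} (hx : 0 ≤ x) (z : ℂ) :
    ‖cpowZero x z‖ = if x = 0 then 0 else x ^ z.re := by
  unfold cpowZero
  split_ifs with h
  · exact norm_zero
  · exact Complex.norm_cpow_eq_rpow_re_of_pos (lt_of_le_of_ne hx (Ne.symm h)) z

lemma cpowZero_ofReal {x : ℝ} (hx : 0 ≤ x) (r : ℝ) :
    cpowZero x (r : ℂ) = ((if x = 0 then 0 else x ^ r : ℝ) : ℂ) := by
  unfold cpowZero
  split_ifs with h
  · exact Complex.ofReal_zero.symm
  · exact (Complex.ofReal_cpow hx r).symm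

lemma cpowZero_add (x : ℝ) (z w : ℂ) : cpowZero x (z + w) = cpowZero x z * cpowZero x w := by
  unfold cpowZero
  split_ifs with h
  · exact (zero_mul _).symm
  · exact Complex.cpow_add _ _ (Complex.ofReal_ne_zero.2 h)

/-- Entire functions that are bounded on the strip `0 ≤ re z ≤ 1`. -/
def StripBounded (f : ℂ → ℂ) : Prop :=
  Differentiable ℂ f ∧ ∃ C, ∀ z : ℂ, 0 ≤ z.re → z.re ≤ 1 → ‖f z‖ ≤ C

namespace StripBounded

lemma const (c : ℂ) : StripBounded fun _ => c :=
  ⟨differentiable_const c, ‖c‖, fun _ _ _ => le_rfl⟩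

lemma mul {f g : ℂ → ℂ} (hf : StripBounded f) (hg : StripBounded g) :
    StripBounded fun z => f z * g z := by
  obtain ⟨hf, C, hC⟩ := hf
  obtain ⟨hg, D, hD⟩ := hg
  refine ⟨hf.mul hg, C * D, fun z h0 h1 => ?_⟩
  rw [norm_mul]
  exact mul_le_mul (hC z h0 h1) (hD z h0 h1) (norm_nonneg _) ((norm_nonneg _).trans (hC z h0 h1))

lemma sum {ι : Type*} (s : Finset ι) {f : ι → ℂ → ℂ} (hf : ∀ i ∈ s, StripBounded (f i)) :
    StripBounded fun z => ∑ i ∈ s, f i z := by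
  refine ⟨Differentiable.fun_sum fun i hi => (hf i hi).1, ?_⟩
  choose! C hC using fun i hi => (hf i hi).2
  exact ⟨∑ i ∈ s, C i, fun z h0 h1 =>
    (norm_sum_le _ _).trans (Finset.sum_le_sum fun i hi => hC i hi z h0 h1)⟩

lemma cpowZero {x : ℝ} (hx : 0 ≤ x) (a b : ℝ) :
    StripBounded fun z => cpowZero x (a * z + b) := by
  rcases hx.eq_or_lt with rfl | hx
  · simpa [_root_.cpowZero] using const 0
  have hx' : (x : ℂ) ≠ 0 := Complex.ofReal_ne_zero.2 hx.ne'
  constructor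
  · simp only [_root_.cpowZero, if_neg hx.ne']
    exact Differentiable.const_cpow (by fun_prop) (Or.inl hx')
  · have hc : ContinuousOn (fun t : ℝ => x ^ (a * t + b)) (Set.Icc 0 1) :=
      (Continuous.rpow continuous_const (by fun_prop) fun _ => Or.inl hx.ne').continuousOn
    obtain ⟨C, hC⟩ := isCompact_Icc.exists_bound_of_continuousOn hc
    refine ⟨C, fun z h0 h1 => ?_⟩
    have := hC z.re ⟨h0, h1⟩
    rw [Real.norm_of_nonneg (Real.rpow_nonneg hx.le _)] at this
    rw [norm_cpowZero hx.le, if_neg hx.ne']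
    simpa using this

lemma matrix_mul {l m o : Type*} [Fintype m] {F : ℂ → Matrix l m ℂ} {G : ℂ → Matrix m o ℂ}
    (hF : ∀ i j, StripBounded fun z => F z i j) (hG : ∀ i j, StripBounded fun z => G z i j)
    (i : l) (j : o) : StripBounded fun z => (F z * G z) i j := by
  simp only [Matrix.mul_apply]
  exact sum _ fun k _ => (hF i k).mul (hG k j)

lemma const_matrix_mul {l m o : Type*} [Fintype m] (N : Matrix l m ℂ) {G : ℂ → Matrix m o ℂ}
    (hG : ∀ i j, StripBounded fun z => G z i j) (i : l) (j : o) :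
    StripBounded fun z => (N * G z) i j :=
  matrix_mul (F := fun _ => N) (fun _ _ => const _) hG i j

lemma matrix_mul_const {l m o : Type*} [Fintype m] (N : Matrix m o ℂ) {F : ℂ → Matrix l m ℂ}
    (hF : ∀ i j, StripBounded fun z => F z i j) (i : l) (j : o) :
    StripBounded fun z => (F z * N) i j :=
  matrix_mul (G := fun _ => N) hF (fun _ _ => const _) i j

lemma norm_le_interp {f : ℂ → ℂ} (hf : StripBounded f) {a b : ℝ}
    (ha : ∀ z : ℂ, z.re = 0 → ‖f z‖ ≤ a) (hb : ∀ z : ℂ, z.re = 1 → ‖f z‖ ≤ b)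
    {θ : ℝ} (h0 : 0 ≤ θ) (h1 : θ ≤ 1) : ‖f θ‖ ≤ a ^ (1 - θ) * b ^ θ := by
  obtain ⟨hd, C, hC⟩ := hf
  have h := Complex.HadamardThreeLines.norm_le_interp_of_mem_verticalClosedStrip₀₁' f
    (z := (θ : ℂ)) (a := a) (b := b) ⟨h0, h1⟩ hd.diffContOnCl
    ⟨C, by rintro _ ⟨z, hz, rfl⟩; exact hC z hz.1 hz.2⟩ ha hb
  simpa using h

end StripBounded

/-- Stein interpolation between the operator norm on `re z = 0` and the Schatten `q`-norm on
`re z = 1`. -/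
lemma schattenTrace_interpolation {p q : ℝ} (hq : 2 ≤ q) (hqp : q ≤ p) {G : ℂ → Matrix n n ℂ}
    (hG : ∀ i j, StripBounded fun z => G z i j) (h0 : ∀ z : ℂ, z.re = 0 → ‖G z‖ ≤ 1) {M : ℝ}
    (h1 : ∀ z : ℂ, z.re = 1 → ∃ U ∈ Matrix.unitaryGroup n ℂ, ∃ W ∈ Matrix.unitaryGroup n ℂ,
      ∃ Y : Matrix n n ℂ, G z = U * Y * W ∧ schattenTrace q Y ≤ M) :
    schattenTrace p (G ((q / p : ℝ) : ℂ)) ≤ M := by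
  have hq0 : 0 < q := by linarith
  have hp0 : 0 < p := by linarith
  have hM : 0 ≤ M := by
    obtain ⟨-, -, -, -, Y, -, hY⟩ := h1 1 Complex.one_re
    exact (schattenTrace_nonneg hq0 Y).trans hY
  set X := G ((q / p : ℝ) : ℂ) with hX
  set E := rightSingular X with hE
  have hEmem : E ∈ Matrix.unitaryGroup n ℂ := rightSingular_mem X
  set S := schattenTrace p X with hS
  have hSsum : S = ∑ i, singVal X i ^ p := schattenTrace_eq_sum hp0 X
  have hS0 : 0 ≤ S := schattenTrace_nonneg hp0 X
  rcases hS0.eq_or_lt with hSz | hSpos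
  · rwa [← hSz]
  set F : ℂ → ℂ := fun z => ∑ i, cpowZero (singVal X i) ((-(p / q) : ℝ) * z + (p - 1 : ℝ)) *
    ((X * E)ᴴ * (G z * E)) i i with hF
  have hFbdd : StripBounded F := StripBounded.sum _ fun i _ =>
    (StripBounded.cpowZero (singVal_nonneg X i) _ _).mul
      (StripBounded.const_matrix_mul _ (StripBounded.matrix_mul_const _ hG) i i)
  have hFnorm (z : ℂ) : ‖F z‖ ≤
      ∑ i, singVal X i ^ (p - p / q * z.re) * ‖euclideanCol (G z * E) i‖ := by
    refine (norm_sum_le _ _).trans (Finset.sum_le_sum fun i _ => ?_)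
    have hs := singVal_nonneg X i
    have hin : ‖((X * E)ᴴ * (G z * E)) i i‖ ≤ singVal X i * ‖euclideanCol (G z * E) i‖ := by
      rw [← inner_euclideanCol]
      exact norm_inner_le_norm _ _
    rw [norm_mul, norm_cpowZero hs]
    split_ifs with h
    · rw [zero_mul]
      positivity
    · refine (mul_le_mul_of_nonneg_left hin (Real.rpow_nonneg hs _)).trans_eq ?_
      rw [← mul_assoc, ← Real.rpow_add_one h]
      congr 2
      simp
      ring
  have hF0 (z : ℂ) (hz : z.re = 0) : ‖F z‖ ≤ S := by
    refine (hFnorm z).trans ?_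
    rw [hSsum]
    refine Finset.sum_le_sum fun i _ => ?_
    rw [hz, mul_zero, sub_zero]
    exact mul_le_of_le_one_right (Real.rpow_nonneg (singVal_nonneg X i) _)
      ((norm_euclideanCol_le hEmem i).trans (h0 z hz))
  have hF1 (z : ℂ) (hz : z.re = 1) : ‖F z‖ ≤ S ^ (1 - 1 / q) * M ^ (1 / q) := by
    refine (hFnorm z).trans ?_
    obtain ⟨U, hU, W, hW, Y, hGz, hY⟩ := h1 z hz
    have hconj : (Real.conjExponent q).HolderConjugate q :=
      (Real.HolderConjugate.conjExponent (by linarith)).symm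
    have hinv : 1 / Real.conjExponent q = 1 - 1 / q := by
      have := hconj.inv_add_inv_eq_one
      rw [one_div, one_div]
      linarith
    have hexp : (p - p / q * z.re) * Real.conjExponent q = p := by
      have h2 : p - p / q * z.re = p * (1 / Real.conjExponent q) := by rw [hinv, hz]; ring
      rw [h2, mul_assoc, one_div, inv_mul_cancel₀ hconj.ne_zero, mul_one]
    refine (Real.inner_le_Lp_mul_Lq_of_nonneg Finset.univ hconj
      (fun i _ => Real.rpow_nonneg (singVal_nonneg X i) _) (fun i _ => norm_nonneg _)).trans ?_
    rw [hinv]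
    have e1 : ∑ i, (singVal X i ^ (p - p / q * z.re)) ^ Real.conjExponent q = S := by
      rw [hSsum]
      refine Finset.sum_congr rfl fun i _ => ?_
      rw [← Real.rpow_mul (singVal_nonneg X i), hexp]
    rw [e1]
    refine mul_le_mul_of_nonneg_left (Real.rpow_le_rpow
      (Finset.sum_nonneg fun i _ => Real.rpow_nonneg (norm_nonneg _) _) ?_ (by positivity))
      (Real.rpow_nonneg hS0 _)
    refine le_trans (le_of_eq ?_) ((sum_norm_euclideanCol_rpow_le hq Y (mul_mem hW hEmem)).trans hY)
    refine Finset.sum_congr rfl fun i _ => ?_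
    rw [hGz, Matrix.mul_assoc, Matrix.mul_assoc, norm_euclideanCol_unitary_mul hU]
  have hFθ : F ((q / p : ℝ) : ℂ) = (S : ℂ) := by
    rw [hSsum, Complex.ofReal_sum]
    refine Finset.sum_congr rfl fun i _ => ?_
    have hs := singVal_nonneg X i
    have hexp : (((-(p / q) : ℝ) : ℂ) * ((q / p : ℝ) : ℂ) + ((p - 1 : ℝ) : ℂ)) =
        ((p - 2 : ℝ) : ℂ) := by
      rw [← Complex.ofReal_mul, ← Complex.ofReal_add]
      congr 1
      field_simp
      ring
    rw [hexp, cpowZero_ofReal hs, ← hX, ← inner_euclideanCol, inner_self_eq_norm_sq_to_K]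
    change _ * ((singVal X i : ℝ) : ℂ) ^ 2 = _
    split_ifs with h
    · simp [h, Real.zero_rpow hp0.ne']
    · rw [← Complex.ofReal_pow, ← Complex.ofReal_mul, ← Real.rpow_natCast,
        ← Real.rpow_add (lt_of_le_of_ne hs (Ne.symm h))]
      congr 2
      push_cast
      ring
  have key := hFbdd.norm_le_interp hF0 hF1 (θ := q / p) (by positivity)
    ((div_le_one hp0).2 hqp)
  rw [hFθ, Complex.norm_real, Real.norm_of_nonneg hS0,
    Real.mul_rpow (Real.rpow_nonneg hS0 _) (Real.rpow_nonneg hM _), ← Real.rpow_mul hS0,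
    ← Real.rpow_mul hM, ← mul_assoc, ← Real.rpow_add hSpos] at key
  have e1 : 1 - q / p + (1 - 1 / q) * (q / p) = 1 - 1 / p := by
    field_simp
    ring
  have e2 : 1 / q * (q / p) = 1 / p := by field_simp
  rw [e1, e2, Real.rpow_sub hSpos, Real.rpow_one, div_mul_eq_mul_div,
    le_div_iff₀ (Real.rpow_pos_of_pos hSpos _), mul_le_mul_iff_right₀ hSpos] at key
  exact (Real.rpow_le_rpow_iff hS0 hM (by positivity)).1 key

lemma hermFC_eq {A : Matrix n n ℂ} (hA : A.IsHermitian) (f : ℝ → ℂ) :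
    hermFC A f = (hA.eigenvectorUnitary : Matrix n n ℂ) * diagonal (f ∘ hA.eigenvalues) *
      (hA.eigenvectorUnitary : Matrix n n ℂ)ᴴ :=
  dif_pos hA

lemma hermFC_congr {A : Matrix n n ℂ} (hA : A.IsHermitian) {f g : ℝ → ℂ}
    (h : ∀ i, f (hA.eigenvalues i) = g (hA.eigenvalues i)) : hermFC A f = hermFC A g := by
  have : f ∘ hA.eigenvalues = g ∘ hA.eigenvalues := funext h
  rw [hermFC_eq hA, hermFC_eq hA, this]

lemma hermFC_ofReal {A : Matrix n n ℂ} (hA : A.IsHermitian) :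
    hermFC A (fun x => (x : ℂ)) = A := by
  rw [hermFC_eq hA]
  exact hA.spectral_theorem.symm

lemma hermFC_one {A : Matrix n n ℂ} (hA : A.IsHermitian) :
    hermFC A (fun _ => 1) = 1 := by
  have hE : (hA.eigenvectorUnitary : Matrix n n ℂ) * (hA.eigenvectorUnitary : Matrix n n ℂ)ᴴ = 1 :=
    Matrix.mem_unitaryGroup_iff.1 hA.eigenvectorUnitary.2
  have hd : diagonal ((fun _ : ℝ => (1 : ℂ)) ∘ hA.eigenvalues) = 1 := diagonal_one
  rw [hermFC_eq hA, hd, Matrix.mul_one, hE]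

lemma hermFC_mul {A : Matrix n n ℂ} (hA : A.IsHermitian) (f g : ℝ → ℂ) :
    hermFC A f * hermFC A g = hermFC A (fun x => f x * g x) := by
  have hE : (hA.eigenvectorUnitary : Matrix n n ℂ)ᴴ * (hA.eigenvectorUnitary : Matrix n n ℂ) = 1 :=
    Matrix.mem_unitaryGroup_iff'.1 hA.eigenvectorUnitary.2
  rw [hermFC_eq hA, hermFC_eq hA, hermFC_eq hA]
  calc _ = (hA.eigenvectorUnitary : Matrix n n ℂ) * (diagonal (f ∘ hA.eigenvalues) *
        (((hA.eigenvectorUnitary : Matrix n n ℂ)ᴴ * (hA.eigenvectorUnitary : Matrix n n ℂ)) *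
          diagonal (g ∘ hA.eigenvalues))) * (hA.eigenvectorUnitary : Matrix n n ℂ)ᴴ := by
        simp only [Matrix.mul_assoc]
    _ = _ := by
        rw [hE, Matrix.one_mul, diagonal_mul_diagonal]
        rfl

lemma hermFC_conjTranspose {A : Matrix n n ℂ} (hA : A.IsHermitian) (f : ℝ → ℂ) :
    (hermFC A f)ᴴ = hermFC A (fun x => star (f x)) := by
  rw [hermFC_eq hA, hermFC_eq hA, conjTranspose_mul, conjTranspose_mul,
    conjTranspose_conjTranspose, diagonal_conjTranspose, Matrix.mul_assoc]
  rfl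

lemma commute_hermFC {A : Matrix n n ℂ} (hA : A.IsHermitian) (f : ℝ → ℂ) :
    Commute (hermFC A f) A := by
  have h : hermFC A f * hermFC A (fun x => (x : ℂ)) = hermFC A (fun x => (x : ℂ)) * hermFC A f := by
    rw [hermFC_mul hA, hermFC_mul hA]
    simp_rw [mul_comm]
  rwa [hermFC_ofReal hA] at h

lemma hermFC_mem_unitaryGroup {A : Matrix n n ℂ} (hA : A.IsHermitian) {f : ℝ → ℂ}
    (hf : ∀ x, ‖f x‖ = 1) : hermFC A f ∈ Matrix.unitaryGroup n ℂ := by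
  rw [Matrix.mem_unitaryGroup_iff, star_eq_conjTranspose, hermFC_conjTranspose hA, hermFC_mul hA,
    ← hermFC_one hA]
  congr 1
  funext x
  rw [RCLike.star_def, Complex.mul_conj', hf x]
  simp

lemma norm_le_one_of_mem_unitaryGroup {U : Matrix n n ℂ} (hU : U ∈ Matrix.unitaryGroup n ℂ) :
    ‖U‖ ≤ 1 :=
  by
  rcases subsingleton_or_nontrivial (Matrix n n ℂ) with h | h
  · rw [Subsingleton.elim U 0, norm_zero]
    exact zero_le_one
  · exact (CStarRing.norm_of_mem_unitary hU).le

lemma norm_hermFC_le_one {A : Matrix n n ℂ} (hA : A.IsHermitian) {f : ℝ → ℂ}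
    (hf : ∀ i, ‖f (hA.eigenvalues i)‖ ≤ 1) : ‖hermFC A f‖ ≤ 1 := by
  have hE := norm_le_one_of_mem_unitaryGroup hA.eigenvectorUnitary.2
  have hE' := hE
  rw [← Matrix.l2_opNorm_conjTranspose] at hE'
  have hd : ‖diagonal (f ∘ hA.eigenvalues)‖ ≤ 1 := by
    rw [Matrix.l2_opNorm_diagonal]
    exact (pi_norm_le_iff_of_nonneg zero_le_one).2 hf
  rw [hermFC_eq hA]
  exact (norm_mul_le _ _).trans (mul_le_one₀ ((norm_mul_le _ _).trans
    (mul_le_one₀ hE (norm_nonneg _) hd)) (norm_nonneg _) hE')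

lemma mpow_eq_hermFC (A : Matrix n n ℂ) (z : ℂ) :
    mpow A z = hermFC A (fun x => cpowZero x z) := rfl

lemma norm_mpow_le_one {A : Matrix n n ℂ} (hA : A.PosSemidef) {z : ℂ} (hz : z.re = 0) :
    ‖mpow A z‖ ≤ 1 := by
  refine norm_hermFC_le_one hA.isHermitian fun i => ?_
  change ‖cpowZero _ z‖ ≤ 1
  rw [norm_cpowZero (hA.eigenvalues_nonneg i), hz, Real.rpow_zero]
  split_ifs <;> norm_num

lemma stripBounded_mpow {A : Matrix n n ℂ} (hA : A.PosSemidef) (a : ℝ) (i j : n) :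
    StripBounded fun z => mpow A (a * z) i j := by
  simp only [mpow_eq_hermFC, hermFC_eq hA.isHermitian]
  refine StripBounded.matrix_mul_const _ (StripBounded.const_matrix_mul _ fun k l => ?_) i j
  by_cases h : k = l
  · subst h
    simpa using StripBounded.cpowZero (hA.eigenvalues_nonneg k) a 0
  · simpa [diagonal_apply_ne _ h] using StripBounded.const 0

/-- The unitary `A ^ (i s)` of a positive semi-definite matrix, acting as the identity on the
kernel of `A`. -/
def mphase (A : Matrix n n ℂ) (s : ℝ) : Matrix n n ℂ :=
  hermFC A (fun x => Complex.exp ((s * Real.log x : ℝ) * Complex.I))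

lemma mphase_mem_unitaryGroup {A : Matrix n n ℂ} (hA : A.IsHermitian) (s : ℝ) :
    mphase A s ∈ Matrix.unitaryGroup n ℂ :=
  hermFC_mem_unitaryGroup hA fun _ => Complex.norm_exp_ofReal_mul_I _

lemma mpow_eq_mpow_mul_mphase {A : Matrix n n ℂ} (hA : A.PosSemidef) (z : ℂ) :
    mpow A z = mpow A (z.re : ℂ) * mphase A z.im := by
  rw [mpow_eq_hermFC, mpow_eq_hermFC, mphase, hermFC_mul hA.isHermitian]
  refine hermFC_congr hA.isHermitian fun i => ?_
  set x := hA.isHermitian.eigenvalues i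
  have hx : 0 ≤ x := hA.eigenvalues_nonneg i
  conv_lhs => rw [← Complex.re_add_im z, cpowZero_add]
  by_cases h : x = 0
  · simp [cpowZero, h]
  · congr 1
    rw [cpowZero, if_neg h, Complex.cpow_def_of_ne_zero (Complex.ofReal_ne_zero.2 h),
      ← Complex.ofReal_log hx]
    congr 1
    push_cast
    ring

lemma mpow_eq_mphase_mul_mpow {A : Matrix n n ℂ} (hA : A.PosSemidef) (z : ℂ) :
    mpow A z = mphase A z.im * mpow A (z.re : ℂ) := by
  rw [mpow_eq_mpow_mul_mphase hA, mpow_eq_hermFC, mphase, hermFC_mul hA.isHermitian,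
    hermFC_mul hA.isHermitian]
  simp_rw [mul_comm]

section TensorExtension

variable {A B C : Type*} [Fintype A] [DecidableEq A] [Fintype B] [DecidableEq B]
    [Fintype C] [DecidableEq C]

/-- `extAC` as a homomorphism of star algebras. -/
def extACHom : Matrix (A × C) (A × C) ℂ →⋆ₐ[ℂ] Matrix (A × B × C) (A × B × C) ℂ where
  toFun := extAC
  map_one' := by
    ext ⟨a, b, c⟩ ⟨a', b', c'⟩
    simp only [extAC, Matrix.of_apply, Matrix.one_apply, Prod.mk.injEq]
    split_ifs <;> simp_all
  map_mul' M N := by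
    ext ⟨a, b, c⟩ ⟨a', b', c'⟩
    simp [extAC, Matrix.mul_apply, Fintype.sum_prod_type, ite_mul, mul_ite]
  map_zero' := by ext; simp [extAC]
  map_add' M N := by ext; simp [extAC, mul_add]
  commutes' r := by
    ext ⟨a, b, c⟩ ⟨a', b', c'⟩
    simp only [extAC, Matrix.of_apply, Matrix.algebraMap_matrix_apply, Prod.mk.injEq]
    split_ifs <;> simp_all
  map_star' M := by
    ext ⟨a, b, c⟩ ⟨a', b', c'⟩
    by_cases hb : b = b'
    on_goal 2 => simp [extAC, hb, Ne.symm hb]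
    subst hb
    simp [extAC]

/-- `extBC` as a homomorphism of star algebras. -/
def extBCHom : Matrix (B × C) (B × C) ℂ →⋆ₐ[ℂ] Matrix (A × B × C) (A × B × C) ℂ where
  toFun := extBC
  map_one' := by
    ext ⟨a, b, c⟩ ⟨a', b', c'⟩
    simp only [extBC, Matrix.of_apply, Matrix.one_apply, Prod.mk.injEq]
    split_ifs <;> simp_all
  map_mul' M N := by
    ext ⟨a, b, c⟩ ⟨a', b', c'⟩
    simp [extBC, Matrix.mul_apply, Fintype.sum_prod_type, ite_mul, mul_ite]
  map_zero' := by ext; simp [extBC]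
  map_add' M N := by ext; simp [extBC, mul_add]
  commutes' r := by
    ext ⟨a, b, c⟩ ⟨a', b', c'⟩
    simp only [extBC, Matrix.of_apply, Matrix.algebraMap_matrix_apply, Prod.mk.injEq]
    split_ifs <;> simp_all
  map_star' M := by
    ext ⟨a, b, c⟩ ⟨a', b', c'⟩
    by_cases ha : a = a'
    on_goal 2 => simp [extBC, ha, Ne.symm ha]
    subst ha
    simp [extBC]

/-- `extC` as a homomorphism of star algebras. -/
def extCHom : Matrix C C ℂ →⋆ₐ[ℂ] Matrix (A × B × C) (A × B × C) ℂ where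
  toFun := extC
  map_one' := by
    ext ⟨a, b, c⟩ ⟨a', b', c'⟩
    simp only [extC, Matrix.of_apply, Matrix.one_apply, Prod.mk.injEq]
    split_ifs <;> simp_all
  map_mul' M N := by
    ext ⟨a, b, c⟩ ⟨a', b', c'⟩
    simp [extC, Matrix.mul_apply, Fintype.sum_prod_type, ite_mul, mul_ite]
  map_zero' := by ext; simp [extC]
  map_add' M N := by ext; simp [extC, mul_add]
  commutes' r := by
    ext ⟨a, b, c⟩ ⟨a', b', c'⟩
    simp only [extC, Matrix.of_apply, Matrix.algebraMap_matrix_apply, Prod.mk.injEq]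
    split_ifs <;> simp_all
  map_star' M := by
    ext ⟨a, b, c⟩ ⟨a', b', c'⟩
    by_cases ha : a = a'
    on_goal 2 => simp [extC, ha, Ne.symm ha]
    subst ha
    by_cases hb : b = b'
    on_goal 2 => simp [extC, hb, Ne.symm hb]
    subst hb
    simp [extC]

omit [DecidableEq A] [Fintype C] [DecidableEq C] [Fintype A] [DecidableEq B] in
lemma posSemidef_ptraceB {ρ : Matrix (A × B × C) (A × B × C) ℂ} (hρ : ρ.PosSemidef) :
    (ptraceB ρ).PosSemidef := by
  have : ptraceB ρ =
      ∑ b : B, ρ.submatrix (fun x : A × C => (x.1, b, x.2)) (fun x => (x.1, b, x.2)) := by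
    ext x y
    simp [ptraceB, Matrix.sum_apply]
  rw [this]
  exact Matrix.posSemidef_sum _ fun b _ => hρ.submatrix _

omit [DecidableEq A] [Fintype C] [DecidableEq C] [Fintype B] [DecidableEq B] in
lemma posSemidef_ptraceA {ρ : Matrix (A × B × C) (A × B × C) ℂ} (hρ : ρ.PosSemidef) :
    (ptraceA ρ).PosSemidef := by
  have : ptraceA ρ =
      ∑ a : A, ρ.submatrix (fun x : B × C => (a, x)) (fun x => (a, x)) := by
    ext x y
    simp [ptraceA, Matrix.sum_apply]
  rw [this]
  exact Matrix.posSemidef_sum _ fun a _ => hρ.submatrix _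

end TensorExtension

section CMI

variable {A B C : Type*} [Fintype A] [DecidableEq A] [Fintype B] [DecidableEq B]
    [Fintype C] [DecidableEq C]

/-- The product `ρ_AC ^ z (I ⊗ V) ρ_C ^ (-z) ρ_BC ^ z`, with three arbitrary matrices in place of
the marginals of a density operator. -/
def cmiProd (P : Matrix (A × C) (A × C) ℂ) (R : Matrix C C ℂ) (Q : Matrix (B × C) (B × C) ℂ)
    (V : Matrix C C ℂ) (z : ℂ) : Matrix (A × B × C) (A × B × C) ℂ :=
  extACHom (mpow P z) * extCHom V * extCHom (mpow R (-z)) * extBCHom (mpow Q z)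

variable {P : Matrix (A × C) (A × C) ℂ} {R : Matrix C C ℂ} {Q : Matrix (B × C) (B × C) ℂ}
  {V : Matrix C C ℂ}

lemma stripBounded_cmiProd (hP : P.PosSemidef) (hR : R.PosSemidef) (hQ : Q.PosSemidef) (r : ℝ)
    (i j : A × B × C) : StripBounded fun z => cmiProd P R Q V (r * z) i j := by
  refine StripBounded.matrix_mul (StripBounded.matrix_mul (StripBounded.matrix_mul_const _
    fun x y => ?_) fun x y => ?_) (fun x y => ?_) i j
  · exact (StripBounded.const _).mul (stripBounded_mpow hP r _ _)
  · have := stripBounded_mpow hR (-r) x.2.2 y.2.2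
    simp only [Complex.ofReal_neg, neg_mul] at this
    exact (StripBounded.const _).mul this
  · exact (StripBounded.const _).mul (stripBounded_mpow hQ r _ _)

lemma norm_map_le_one {m : Type*} [Fintype m] [DecidableEq m]
    (φ : Matrix m m ℂ →⋆ₐ[ℂ] Matrix n n ℂ) {X : Matrix m m ℂ} (hX : ‖X‖ ≤ 1) : ‖φ X‖ ≤ 1 :=
  (NonUnitalStarAlgHom.norm_apply_le φ X).trans hX

lemma map_mem_unitaryGroup {m : Type*} [Fintype m] [DecidableEq m]
    (φ : Matrix m m ℂ →⋆ₐ[ℂ] Matrix n n ℂ) {U : Matrix m m ℂ}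
    (hU : U ∈ Matrix.unitaryGroup m ℂ) : φ U ∈ Matrix.unitaryGroup n ℂ :=
  Unitary.map_mem φ hU

lemma norm_cmiProd_le_one (hP : P.PosSemidef) (hR : R.PosSemidef) (hQ : Q.PosSemidef)
    (hV : V ∈ Matrix.unitaryGroup C ℂ) {z : ℂ} (hz : z.re = 0) : ‖cmiProd P R Q V z‖ ≤ 1 := by
  have h1 := norm_map_le_one (extACHom (B := B)) (norm_mpow_le_one hP hz)
  have h2 := norm_map_le_one (extCHom (A := A) (B := B)) (norm_le_one_of_mem_unitaryGroup hV)
  have h3 := norm_map_le_one (extCHom (A := A) (B := B))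
    (norm_mpow_le_one hR (z := -z) (by simp [hz]))
  have h4 := norm_map_le_one (extBCHom (A := A)) (norm_mpow_le_one hQ hz)
  have h12 := (norm_mul_le _ _).trans (mul_le_one₀ h1 (norm_nonneg _) h2)
  have h123 := (norm_mul_le _ _).trans (mul_le_one₀ h12 (norm_nonneg _) h3)
  exact (norm_mul_le _ _).trans (mul_le_one₀ h123 (norm_nonneg _) h4)

lemma cmiProd_eq (hP : P.PosSemidef) (hR : R.PosSemidef) (hQ : Q.PosSemidef) (z : ℂ) :
    cmiProd P R Q V z = extACHom (mphase P z.im) *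
      cmiProd P R Q (V * mphase R (-z.im)) (z.re : ℂ) * extBCHom (mphase Q z.im) := by
  rw [cmiProd, cmiProd, mpow_eq_mphase_mul_mpow hP, mpow_eq_mphase_mul_mpow hR (-z),
    mpow_eq_mpow_mul_mphase hQ]
  simp only [map_mul, Matrix.mul_assoc, Complex.neg_re, Complex.neg_im, Complex.ofReal_neg]

/-- The values of `‖ρ_AC ^ (1/p) V ρ_C ^ (-1/p) ρ_BC ^ (1/p)‖_p ^ p` over the unitaries `V`
commuting with `ρ_C`. -/
def cmiValues (P : Matrix (A × C) (A × C) ℂ) (R : Matrix C C ℂ) (Q : Matrix (B × C) (B × C) ℂ)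
    (p : ℝ) : Set ℝ :=
  {x | ∃ V ∈ Matrix.unitaryGroup C ℂ, V * R = R * V ∧
    x = schattenTrace p (cmiProd P R Q V ((1 / p : ℝ) : ℂ))}

lemma bddAbove_cmiValues {p : ℝ} (hp : 0 < p) : BddAbove (cmiValues P R Q p) := by
  refine ⟨Fintype.card (A × B × C) *
    (‖extACHom (B := B) (mpow P ((1 / p : ℝ) : ℂ))‖ *
      ‖extCHom (A := A) (B := B) (mpow R (-((1 / p : ℝ) : ℂ)))‖ *
      ‖extBCHom (A := A) (mpow Q ((1 / p : ℝ) : ℂ))‖) ^ p, ?_⟩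
  rintro _ ⟨V, hV, -, rfl⟩
  refine (schattenTrace_le_card_mul hp _).trans ?_
  gcongr
  rw [cmiProd]
  refine (norm_mul_le _ _).trans (mul_le_mul_of_nonneg_right ?_ (norm_nonneg _))
  refine (norm_mul_le _ _).trans (mul_le_mul_of_nonneg_right ?_ (norm_nonneg _))
  exact (norm_mul_le _ _).trans (mul_le_of_le_one_right (norm_nonneg _)
    (norm_map_le_one _ (norm_le_one_of_mem_unitaryGroup hV)))

theorem sSup_cmiValues_antitone (hP : P.PosSemidef) (hR : R.PosSemidef) (hQ : Q.PosSemidef)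
    {p q : ℝ} (hq : 2 ≤ q) (hqp : q ≤ p) :
    sSup (cmiValues P R Q p) ≤ sSup (cmiValues P R Q q) := by
  have hq0 : 0 < q := by linarith
  have hp0 : 0 < p := by linarith
  refine csSup_le ⟨_, 1, one_mem _, by rw [one_mul, mul_one], rfl⟩ ?_
  rintro _ ⟨V, hV, hVR, rfl⟩
  have h := schattenTrace_interpolation hq hqp (M := sSup (cmiValues P R Q q))
    (stripBounded_cmiProd (V := V) hP hR hQ (1 / q))
    (fun z hz => norm_cmiProd_le_one hP hR hQ hV (by simp [hz])) fun z hz => by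
      have hph := mphase_mem_unitaryGroup hR.isHermitian (-(((1 / q : ℝ) : ℂ) * z).im)
      refine ⟨_, map_mem_unitaryGroup extACHom (mphase_mem_unitaryGroup hP.isHermitian _),
        _, map_mem_unitaryGroup extBCHom (mphase_mem_unitaryGroup hQ.isHermitian _),
        _, cmiProd_eq hP hR hQ _, le_csSup (bddAbove_cmiValues hq0)
          ⟨_, mul_mem hV hph, ?_, ?_⟩⟩
      · exact Commute.mul_left hVR (commute_hermFC hR.isHermitian _)
      · rw [Complex.re_ofReal_mul, hz, mul_one]
  have e : ((1 / q : ℝ) : ℂ) * ((q / p : ℝ) : ℂ) = ((1 / p : ℝ) : ℂ) := by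
    rw [← Complex.ofReal_mul]
    congr 1
    field_simp
  rwa [e] at h

end CMI

end SchattenInterpolation

/-- For a density operator `ρ_{ABC}` with invertible marginal `ρ_C` and
reals `2 ≤ q ≤ p`, the quantity
`max_{V_{ρ_C}} ‖ρ_{AC}^{1/p} (I_A ⊗ V_{ρ_C}) ρ_C^{-1/p} ρ_{BC}^{1/p}‖_p^p`, maximized over
unitaries on `H_C` commuting with `ρ_C`, is monotone non-increasing for `p ≥ 2`. -/
theorem max_schatten_p_power_cmi_antitone
    {A B C : Type*} [Fintype A] [DecidableEq A] [Fintype B] [DecidableEq B]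
    [Fintype C] [DecidableEq C]
    (ρ : Matrix (A × B × C) (A × B × C) ℂ) (hρ : ρ.PosSemidef) (htr : ρ.trace = 1)
    (hρC : (ptraceAB ρ).PosDef)
    (p q : ℝ) (hq : 2 ≤ q) (hqp : q ≤ p) :
    sSup {x : ℝ | ∃ V ∈ Matrix.unitaryGroup C ℂ, V * ptraceAB ρ = ptraceAB ρ * V ∧
        x = schattenNorm p
          (extAC (mpow (ptraceB ρ) ((1 / p : ℝ) : ℂ)) * extC (B := B) V *
            extC (mpow (ptraceAB ρ) ((-(1 / p) : ℝ) : ℂ)) *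
            extBC (mpow (ptraceA ρ) ((1 / p : ℝ) : ℂ))) ^ p} ≤
    sSup {x : ℝ | ∃ W ∈ Matrix.unitaryGroup C ℂ, W * ptraceAB ρ = ptraceAB ρ * W ∧
        x = schattenNorm q
          (extAC (mpow (ptraceB ρ) ((1 / q : ℝ) : ℂ)) * extC (B := B) W *
            extC (mpow (ptraceAB ρ) ((-(1 / q) : ℝ) : ℂ)) *
            extBC (mpow (ptraceA ρ) ((1 / q : ℝ) : ℂ))) ^ q} := by
  have h := sSup_cmiValues_antitone (posSemidef_ptraceB hρ) hρC.posSemidef (posSemidef_ptraceA hρ)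
    hq hqp
  simp only [cmiValues, ← schattenNorm_rpow (show 0 < p by linarith),
    ← schattenNorm_rpow (show 0 < q by linarith), cmiProd, ← Complex.ofReal_neg] at h
  exact h
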